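/- arXiv:1009.3663 — 2 statements merged into one kernel-verified Lean document; each statement's English description precedes it below -/
import Mathlib

section
/- Let n, N be positive integers with N ≥ 2n. Let A be an n×N real matrix whose columns all have Euclidean norm 1 and such that A·Aᵀ = (N/n)·Idₙ. Then A has at least N + 2(n − gcd(N,n)) nonzero entries. -/
open Matrix BigOperators

/- The number of nonzero entries of a matrix. -/
open Classical in
noncomputable def nnzCount {n N : ℕ} (A : Matrix (Fin n) (Fin N) ℝ) : ℕ :=
  (Finset.univ.filter fun p : Fin n × Fin N => A p.1 p.2 ≠ 0).card

section SetFamilies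

variable {ι κ : Type*} [DecidableEq ι] [DecidableEq κ]

/-- A set of indices is closed for a family of sets if members indexed inside it are
disjoint from members indexed outside it. -/
def IsClosedFor (R : ι → Finset κ) (S : Finset ι) : Prop :=
  ∀ i ∈ S, ∀ k ∉ S, Disjoint (R i) (R k)

/-- If no two members of the family meet in exactly one point, then inside a nonempty closed set
there is a nonempty closed subset in which points are covered with excess at least
`2 * (card - 1)`. -/
theorem IsClosedFor.exists_connected {R : ι → Finset κ}
    (hR : ∀ i k, i ≠ k → (R i ∩ R k).card ≠ 1) {S : Finset ι} (hS : IsClosedFor R S)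
    (hne : S.Nonempty) :
    ∃ T ⊆ S, T.Nonempty ∧ IsClosedFor R T ∧
      (T.biUnion R).card + 2 * T.card ≤ ∑ i ∈ T, (R i).card + 2 := by
  classical
  obtain ⟨v, hv⟩ := hne
  let F := S.powerset.filter fun T => T.Nonempty ∧
    (T.biUnion R).card + 2 * T.card ≤ ∑ i ∈ T, (R i).card + 2
  have hF : F.Nonempty := ⟨{v}, by simp [F, hv]⟩
  obtain ⟨T, hT, hmax⟩ := F.exists_max_image Finset.card hF
  obtain ⟨hTS, hTne, hcard⟩ : T ⊆ S ∧ T.Nonempty ∧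
      (T.biUnion R).card + 2 * T.card ≤ ∑ i ∈ T, (R i).card + 2 := by
    simpa [F] using hT
  refine ⟨T, hTS, hTne, ?_, hcard⟩
  intro i hi k hk
  by_contra hdis
  have hkS : k ∈ S := by
    by_contra hkS
    exact hdis (hS i (hTS hi) k hkS)
  have hik : i ≠ k := by
    rintro rfl
    exact hk hi
  have hpos : (R i ∩ R k).card ≠ 0 := by
    rwa [Ne, Finset.card_eq_zero, ← Finset.disjoint_iff_inter_eq_empty]
  have htwo : 2 ≤ (R i ∩ R k).card := by
    have := hR i k hik
    omega
  have hsub : (R i ∩ R k).card ≤ (R k ∩ T.biUnion R).card := by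
    refine Finset.card_le_card fun j hj => ?_
    rw [Finset.mem_inter] at hj ⊢
    exact ⟨hj.2, Finset.mem_biUnion.2 ⟨i, hi, hj.1⟩⟩
  have hunion := Finset.card_union_add_card_inter (R k) (T.biUnion R)
  have hmem : insert k T ∈ F := by
    simp only [F, Finset.mem_filter, Finset.mem_powerset]
    refine ⟨Finset.insert_subset hkS hTS, Finset.insert_nonempty _ _, ?_⟩
    rw [Finset.biUnion_insert, Finset.sum_insert hk, Finset.card_insert_of_notMem hk]
    omega
  have := hmax _ hmem
  rw [Finset.card_insert_of_notMem hk] at this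
  omega

/-- If every nonempty closed set has at least `d` elements, then a closed set splits into some
number `c` of parts with `c * d ≤ card`, and points are covered with excess at least
`2 * (card - c)`. -/
theorem IsClosedFor.exists_parts {R : ι → Finset κ}
    (hR : ∀ i k, i ≠ k → (R i ∩ R k).card ≠ 1) {d : ℕ}
    (hd : ∀ T : Finset ι, T.Nonempty → IsClosedFor R T → d ≤ T.card)
    {S : Finset ι} (hS : IsClosedFor R S) :
    ∃ c, c * d ≤ S.card ∧
      (S.biUnion R).card + 2 * S.card ≤ ∑ i ∈ S, (R i).card + 2 * c := by
  induction S using Finset.strongInduction with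
  | H S ih =>
    rcases S.eq_empty_or_nonempty with rfl | hne
    · exact ⟨0, by simp⟩
    obtain ⟨T, hTS, hTne, hT, hcard⟩ := hS.exists_connected hR hne
    have hdiff : IsClosedFor R (S \ T) := by
      intro i hi k hk
      rw [Finset.mem_sdiff] at hi hk
      by_cases hkT : k ∈ T
      · exact (hT k hkT i hi.2).symm
      · exact hS i hi.1 k fun hkS => hk ⟨hkS, hkT⟩
    obtain ⟨c, hc, hcov⟩ := ih (S \ T) (Finset.sdiff_ssubset hTS hTne) hdiff
    have hST := Finset.card_sdiff_add_card_eq_card hTS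
    have hsum := Finset.sum_sdiff (f := fun i => (R i).card) hTS
    have hunion : (S.biUnion R).card ≤ ((S \ T).biUnion R).card + (T.biUnion R).card := by
      rw [← Finset.sdiff_union_of_subset hTS, Finset.union_biUnion,
        Finset.sdiff_union_of_subset hTS]
      exact Finset.card_union_le _ _
    have hdT := hd T hTne hT
    refine ⟨c + 1, ?_, ?_⟩
    · rw [add_mul, one_mul]
      omega
    · omega

end SetFamilies

open Classical in
/-- The set of columns in which a given row of a matrix is nonzero. -/
noncomputable def rowSupport {n N : ℕ} (A : Matrix (Fin n) (Fin N) ℝ) (i : Fin n) :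
    Finset (Fin N) :=
  Finset.univ.filter fun j => A i j ≠ 0

theorem mem_rowSupport {n N : ℕ} {A : Matrix (Fin n) (Fin N) ℝ} {i : Fin n} {j : Fin N} :
    j ∈ rowSupport A i ↔ A i j ≠ 0 := by
  simp [rowSupport]

theorem nnzCount_eq_sum_card_rowSupport {n N : ℕ} (A : Matrix (Fin n) (Fin N) ℝ) :
    nnzCount A = ∑ i, (rowSupport A i).card := by
  classical
  rw [nnzCount, Finset.card_filter, Fintype.sum_prod_type]
  refine Finset.sum_congr rfl fun i _ => ?_
  rw [rowSupport, Finset.card_filter]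

theorem card_rowSupport_inter_ne_one {n N : ℕ} {A : Matrix (Fin n) (Fin N) ℝ} {i k : Fin n}
    (h : ∑ j, A i j * A k j = 0) : (rowSupport A i ∩ rowSupport A k).card ≠ 1 := by
  intro h_one
  obtain ⟨j, hj⟩ := Finset.card_eq_one.1 h_one
  have hmem : ∀ l, (A i l ≠ 0 ∧ A k l ≠ 0) ↔ l = j := by
    intro l
    rw [← mem_rowSupport, ← mem_rowSupport, ← Finset.mem_inter, hj, Finset.mem_singleton]
  rw [Finset.sum_eq_single_of_mem j (Finset.mem_univ j)] at h
  · exact mul_ne_zero ((hmem j).2 rfl).1 ((hmem j).2 rfl).2 h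
  · intro l _ hl
    by_contra hne
    exact hl ((hmem l).1 (mul_ne_zero_iff.1 hne))

/-- In a matrix with unit columns, the squared mass of a closed set of rows is the number of
columns it covers. -/
theorem IsClosedFor.sum_sq_eq {n N : ℕ} {A : Matrix (Fin n) (Fin N) ℝ}
    (hcol : ∀ j, ∑ i, (A i j) ^ 2 = 1) {T : Finset (Fin n)} (hT : IsClosedFor (rowSupport A) T) :
    ∑ i ∈ T, ∑ j, (A i j) ^ 2 = ((T.biUnion (rowSupport A)).card : ℝ) := by
  have hcolT : ∀ j, ∑ i ∈ T, (A i j) ^ 2 = if j ∈ T.biUnion (rowSupport A) then 1 else 0 := by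
    intro j
    split_ifs with hj
    · obtain ⟨i, hi, hij⟩ := Finset.mem_biUnion.1 hj
      rw [← hcol j]
      refine Finset.sum_subset (Finset.subset_univ _) fun k _ hk => ?_
      by_contra hne
      exact Finset.disjoint_left.1 (hT i hi k hk) hij
        (mem_rowSupport.2 fun h => hne (by simp [h]))
    · refine Finset.sum_eq_zero fun i hi => ?_
      by_contra hne
      exact hj (Finset.mem_biUnion.2 ⟨i, hi, mem_rowSupport.2 fun h => hne (by simp [h])⟩)
  rw [Finset.sum_comm, Finset.sum_congr rfl fun j _ => hcolT j, Finset.sum_boole,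
    Finset.filter_mem_eq_inter, Finset.univ_inter]

theorem stmt_10 {n N : ℕ} (hn : 0 < n) (hN : 0 < N) (hNn : 2 * n ≤ N)
    (A : Matrix (Fin n) (Fin N) ℝ)
    (hcol : ∀ i, ∑ k, (A k i) ^ 2 = 1)
    (htight : A * Aᵀ = ((N : ℝ) / (n : ℝ)) • (1 : Matrix (Fin n) (Fin n) ℝ)) :
    N + 2 * (n - Nat.gcd N n) ≤ nnzCount A := by
  have hinner : ∀ i k, ∑ j, A i j * A k j = if i = k then (N : ℝ) / n else 0 := by
    intro i k
    have h := congrFun (congrFun htight i) k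
    simpa [Matrix.mul_apply, Matrix.one_apply] using h
  have hR : ∀ i k, i ≠ k → (rowSupport A i ∩ rowSupport A k).card ≠ 1 := fun i k hik =>
    card_rowSupport_inter_ne_one (by rw [hinner, if_neg hik])
  have hg : 0 < N.gcd n := Nat.gcd_pos_of_pos_left n hN
  have hd : ∀ T : Finset (Fin n), T.Nonempty → IsClosedFor (rowSupport A) T →
      n / N.gcd n ≤ T.card := by
    intro T hTne hT
    have hmass := hT.sum_sq_eq hcol
    have hrow : ∀ i, ∑ j, (A i j) ^ 2 = (N : ℝ) / n := fun i => by
      simpa [sq] using hinner i i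
    simp only [hrow, Finset.sum_const, nsmul_eq_mul] at hmass
    have hn' : (n : ℝ) ≠ 0 := by positivity
    field_simp at hmass
    have hnat : T.card * N = n * (T.biUnion (rowSupport A)).card := by exact_mod_cast hmass
    have hdvd : n ∣ T.card * N := ⟨_, hnat⟩
    have hdvd' : n / N.gcd n ∣ T.card * (N / N.gcd n) := by
      rw [← Nat.mul_div_assoc _ (Nat.gcd_dvd_left N n)]
      exact Nat.div_dvd_div (Nat.gcd_dvd_right N n) hdvd
    exact Nat.le_of_dvd hTne.card_pos
      ((Nat.coprime_div_gcd_div_gcd hg).symm.dvd_of_dvd_mul_right hdvd')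
  obtain ⟨c, hc, hcov⟩ := IsClosedFor.exists_parts hR hd (S := Finset.univ)
    fun _ _ k hk => absurd (Finset.mem_univ k) hk
  have huniv : Finset.univ.biUnion (rowSupport A) = Finset.univ := by
    refine Finset.eq_univ_of_forall fun j => ?_
    by_contra hj
    have hzero : ∀ i, A i j = 0 := fun i => by
      by_contra h
      exact hj (Finset.mem_biUnion.2 ⟨i, Finset.mem_univ i, mem_rowSupport.2 h⟩)
    simpa [hzero] using hcol j
  rw [huniv, ← nnzCount_eq_sum_card_rowSupport] at hcov
  simp only [Finset.card_univ, Fintype.card_fin] at hc hcov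
  have hcg : c ≤ N.gcd n := by
    have hdpos : 0 < n / N.gcd n := Nat.div_pos (Nat.le_of_dvd hn (Nat.gcd_dvd_right N n)) hg
    refine Nat.le_of_mul_le_mul_right (hc.trans_eq ?_) hdpos
    exact (Nat.mul_div_cancel' (Nat.gcd_dvd_right N n)).symm
  have hgn : N.gcd n ≤ n := Nat.gcd_le_right N hn
  omega
end

section
/- Let n, N be positive integers with N ≥ 2n. Then there exists an n×N real matrix A such that all columns of A have Euclidean norm 1, A·Aᵀ = (N/n)·Idₙ, every column of A has at most 2 nonzero entries, and the total number of nonzero entries of A is exactly N + 2(n − gcd(N,n)). -/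
open Matrix BigOperators

/-- Entry in row `k` of the `i`-th column of block `p`: block `p` starts with the two columns
shared with row `p - 1`, which carry the mass `x p` there, and continues with unit vectors. -/
noncomputable def tetrisEntry (x : ℕ → ℝ) (k p i : ℕ) : ℝ :=
  if k = p then
    if i = 0 then √(1 - x p / 2) else if i = 1 then -√(1 - x p / 2) else 1
  else if k + 1 = p then
    if i < 2 then √(x p / 2) else 0
  else 0

theorem sum_ite_val_succ_eq {M : Type*} [AddCommMonoid M] {n : ℕ} (p : Fin n) (c : M)
    (h : (p : ℕ) = 0 → c = 0) :
    ∑ k : Fin n, (if (k : ℕ) + 1 = p then c else 0) = c := by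
  by_cases hp : (p : ℕ) = 0
  · simp [h hp]
  · rw [Finset.sum_eq_single (⟨p - 1, by omega⟩ : Fin n)]
    · rw [if_pos]
      simp only
      omega
    · intro b _ hb
      rw [if_neg]
      intro h'
      exact hb (Fin.ext (by simp only; omega))
    · simp

theorem sum_tetrisEntry_column {M : Type*} [AddCommMonoid M] {n : ℕ} (x : ℕ → ℝ) (hx0 : x 0 = 0)
    (F : ℝ → M) (hF : F 0 = 0) (p : Fin n) (i : ℕ) :
    ∑ k : Fin n, F (tetrisEntry x k p i) =
      F (tetrisEntry x p p i) + F (if i < 2 then √(x p / 2) else 0) := by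
  have h : ∀ k : Fin n, F (tetrisEntry x k p i) =
      (if k = p then F (tetrisEntry x p p i) else 0) +
      (if (k : ℕ) + 1 = p then F (if i < 2 then √(x p / 2) else 0) else 0) := by
    intro k
    by_cases hk : k = p
    · subst hk
      simp
    · have hk' : (k : ℕ) ≠ p := fun h => hk (Fin.ext h)
      by_cases hk1 : (k : ℕ) + 1 = p <;> simp [tetrisEntry, hk, hk', hk1, hF]
  rw [Finset.sum_congr rfl fun k _ => h k, Finset.sum_add_distrib, sum_ite_val_succ_eq]
  · simp
  · intro hp
    simp [hp, hx0, hF]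

theorem sum_tetrisEntry_block (x : ℕ → ℝ) (hx : ∀ p, 0 ≤ x p) (hx1 : ∀ p, x p ≤ 1)
    (k l p m : ℕ) (hm : 2 ≤ m) :
    ∑ i ∈ Finset.range m, tetrisEntry x k p i * tetrisEntry x l p i =
      if k = l then (if k = p then m - x p else 0) + (if k + 1 = p then x p else 0) else 0 := by
  obtain ⟨q, rfl⟩ := Nat.exists_eq_add_of_le' hm
  have h1 : √(1 - x p / 2) * √(1 - x p / 2) = 1 - x p / 2 :=
    Real.mul_self_sqrt (by linarith [hx1 p])
  have h2 : √(x p / 2) * √(x p / 2) = x p / 2 := Real.mul_self_sqrt (by linarith [hx p])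
  rw [Finset.sum_range_succ', Finset.sum_range_succ']
  simp only [tetrisEntry]
  generalize √(1 - x p / 2) = s at h1 ⊢
  generalize √(x p / 2) = t at h2 ⊢
  by_cases hk : k = p <;> by_cases hl : l = p <;> by_cases hk1 : k + 1 = p <;>
    by_cases hl1 : l + 1 = p <;> by_cases hkl : k = l <;> first
    | (exfalso; omega)
    | (simp [hk, hl, hk1, hl1, hkl, h1, h2] <;> first | done | omega | ring)

theorem card_filter_range_dvd_mul {n : ℕ} (hn : 0 < n) (N : ℕ) :
    ((Finset.range n).filter fun p => n ∣ p * N).card = Nat.gcd N n := by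
  obtain ⟨N', n', hco, hN, hn'⟩ := Nat.exists_coprime N n
  have hg : 0 < Nat.gcd N n := Nat.gcd_pos_of_pos_right _ hn
  generalize Nat.gcd N n = g at hN hn' hg ⊢
  subst hN hn'
  have h : ∀ p, n' * g ∣ p * (N' * g) ↔ p ≡ 0 [MOD n'] := fun p => by
    rw [← mul_assoc, Nat.mul_dvd_mul_iff_right hg, hco.symm.dvd_mul_right,
      Nat.modEq_zero_iff_dvd]
  have hn0 : 0 < n' := Nat.pos_of_mul_pos_right hn
  simp_rw [h]
  rw [← Nat.count_eq_card_filter_range, Nat.count_modEq_card _ hn0]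
  simp [hn0]

open Classical in
theorem stmt_11 {n N : ℕ} (hn : 0 < n) (hN : 0 < N) (hNn : 2 * n ≤ N) :
    ∃ A : Matrix (Fin n) (Fin N) ℝ,
      (∀ i, ∑ k, (A k i) ^ 2 = 1) ∧
      A * Aᵀ = ((N : ℝ) / (n : ℝ)) • (1 : Matrix (Fin n) (Fin n) ℝ) ∧
      (∀ i : Fin N, (Finset.univ.filter fun k : Fin n => A k i ≠ 0).card ≤ 2) ∧
      nnzCount A = N + 2 * (n - Nat.gcd N n) := by
  set f : ℕ → ℕ := fun p => p * N / n with hf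
  set x : ℕ → ℝ := fun p => ((p * N % n : ℕ) : ℝ) / n with hx
  have hn' : (0 : ℝ) < n := by exact_mod_cast hn
  have hx0 : x 0 = 0 := by simp [hx]
  have hxn : x n = 0 := by simp [hx]
  have hxnn : ∀ p, 0 ≤ x p := fun p => by positivity
  have hx1 : ∀ p, x p ≤ 1 := fun p => by
    rw [hx, div_le_one hn']
    exact_mod_cast (Nat.mod_lt _ hn).le
  have hfx : ∀ p : ℕ, (f p : ℝ) + x p = p * (N / n) := fun p => by
    have h : ((n * (p * N / n) + p * N % n : ℕ) : ℝ) = ((p * N : ℕ) : ℝ) := by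
      rw [Nat.div_add_mod]
    push_cast at h
    simp only [hf, hx]
    field_simp
    linarith
  have hstep : ∀ p, f p + 2 ≤ f (p + 1) := fun p => by
    simp only [hf]
    rw [Nat.le_div_iff_mul_le hn]
    have := Nat.div_mul_le_self (p * N) n
    nlinarith
  set m : ℕ → ℕ := fun p => f (p + 1) - f p with hm
  have hm2 : ∀ p, 2 ≤ m p := fun p => by have := hstep p; simp only [hm]; omega
  have hsum : ∑ p : Fin n, m p = N := by
    rw [Fin.sum_univ_eq_sum_range m, Finset.sum_range_tsub]
    · simp [hf, hn]
    · exact monotone_nat_of_le_succ fun p => by have := hstep p; omega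
  have hcard : Fintype.card (Σ p : Fin n, Fin (m p)) = N := by simpa using hsum
  let e : (Σ p : Fin n, Fin (m p)) ≃ Fin N := Fintype.equivFinOfCardEq hcard
  have hu : ∀ p i, tetrisEntry x p p i ≠ 0 := fun p i => by
    have : 0 < √(1 - x p / 2) := Real.sqrt_pos.2 (by linarith [hx1 p])
    simp only [tetrisEntry, if_true]
    split_ifs <;> simp [this.ne']
  have hv : ∀ p, √(x p / 2) ≠ 0 ↔ ¬ n ∣ p * N := fun p => by
    rw [Real.sqrt_ne_zero (by linarith [hxnn p])]
    simp [hx, hn.ne', Nat.dvd_iff_mod_eq_zero]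
  have hcol : ∀ (p : Fin n) (i : ℕ), ∑ k : Fin n, (if tetrisEntry x k p i ≠ 0 then 1 else 0) =
      1 + if i < 2 ∧ ¬ n ∣ p * N then 1 else 0 := fun p i => by
    rw [sum_tetrisEntry_column x hx0 (fun y => if y ≠ 0 then 1 else 0) (by simp),
      if_pos (hu p i)]
    by_cases hi : i < 2 <;> simp only [hi, if_true, if_false, hv] <;> simp
  refine ⟨Matrix.of fun k j => tetrisEntry x k (e.symm j).1 (e.symm j).2, ?_, ?_, ?_, ?_⟩
  · intro j
    change ∑ k : Fin n, tetrisEntry x k (e.symm j).1 (e.symm j).2 ^ 2 = 1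
    generalize e.symm j = a
    obtain ⟨p, i⟩ := a
    rw [sum_tetrisEntry_column x hx0 (fun y => y ^ 2) (by simp)]
    have h1 : √(1 - x p / 2) ^ 2 = 1 - x p / 2 := Real.sq_sqrt (by linarith [hx1 p])
    have h2 : √(x p / 2) ^ 2 = x p / 2 := Real.sq_sqrt (by linarith [hxnn p])
    simp only [tetrisEntry, if_true]
    split_ifs <;> first | omega | ((try simp only [neg_sq, h1, h2]); ring)
  · ext k l
    rw [Matrix.mul_apply, Matrix.smul_apply, smul_eq_mul]
    refine (e.symm.sum_comp fun a => tetrisEntry x k a.1 a.2 * tetrisEntry x l a.1 a.2).trans ?_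
    rw [Fintype.sum_sigma]
    have hblock : ∀ p : Fin n,
        ∑ i : Fin (m p), tetrisEntry x k p i * tetrisEntry x l p i = _ := fun p =>
      (Fin.sum_univ_eq_sum_range (fun i => tetrisEntry x k p i * tetrisEntry x l p i) _).trans
        (sum_tetrisEntry_block x hxnn hx1 k l p (m p) (hm2 p))
    rw [Finset.sum_congr rfl fun p _ => hblock p]
    by_cases hkl : k = l
    · subst hkl
      simp only [if_true, Finset.sum_add_distrib, Matrix.one_apply_eq, mul_one]
      have h1 : ∑ p : Fin n, (if (k : ℕ) = p then (m p : ℝ) - x p else 0) = m k - x k := by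
        simp [← Fin.ext_iff]
      have h2 : ∑ p : Fin n, (if (k : ℕ) + 1 = p then x p else 0) = x (k + 1) := by
        rw [Fin.sum_univ_eq_sum_range (fun p => if (k : ℕ) + 1 = p then x p else 0),
          Finset.sum_ite_eq]
        split_ifs with h
        · rfl
        · rw [Finset.mem_range] at h
          rw [show (k : ℕ) + 1 = n by omega, hxn]
      have h3 : (m k : ℝ) = f (k + 1) - f k := by
        simp only [hm]
        rw [Nat.cast_sub (by have := hstep k; omega)]
      have h4 := hfx k
      have h5 := hfx (k + 1)
      push_cast at h5
      rw [h1, h2, h3]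
      linarith
    · have hkl' : (k : ℕ) ≠ l := fun h => hkl (Fin.ext h)
      simp [hkl, hkl']
  · intro j
    refine ((Finset.card_filter _ _).trans (hcol (e.symm j).1 (e.symm j).2)).trans_le ?_
    split_ifs <;> omega
  · rw [nnzCount, Finset.card_filter, Fintype.sum_prod_type_right]
    refine (e.symm.sum_comp fun a =>
      ∑ k : Fin n, if tetrisEntry x k a.1 a.2 ≠ 0 then 1 else 0).trans ?_
    rw [Fintype.sum_sigma]
    have hblock : ∀ p : Fin n, ∑ i : Fin (m p),
        ∑ k : Fin n, (if tetrisEntry x k p i ≠ 0 then 1 else 0) =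
          m p + 2 * if ¬ n ∣ p * N then 1 else 0 := fun p => by
      simp only [hcol]
      rw [Fin.sum_univ_eq_sum_range (fun i => 1 + if i < 2 ∧ ¬ n ∣ p * N then 1 else 0)]
      obtain ⟨q, hq⟩ := Nat.exists_eq_add_of_le' (hm2 p)
      rw [hq, Finset.sum_range_succ', Finset.sum_range_succ']
      by_cases h : n ∣ p * N <;> simp [h]
    rw [Finset.sum_congr rfl fun p _ => hblock p, Finset.sum_add_distrib, hsum,
      ← Finset.mul_sum, Fin.sum_univ_eq_sum_range (fun p => if ¬ n ∣ p * N then 1 else 0),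
      ← Finset.card_filter]
    have h := Finset.card_filter_add_card_filter_not (s := Finset.range n) (fun p => n ∣ p * N)
    rw [card_filter_range_dvd_mul hn, Finset.card_range] at h
    omega
end
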